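/- Let E be a real Banach space, U, V ⊆ E open, ψ : U → V a C^∞ diffeomorphism with C^∞ inverse ψ⁻¹ : V → U, and k ≥ 1. Then the k-jet prolongation J^k ψ : U × E^k → V × E^k is a C^∞ diffeomorphism, with inverse J^k(ψ⁻¹). (This is the content of Theorem 2.1: the chart overlaps Ψ^k_{βα} = Ψ^k_β ∘ (Ψ^k_α)⁻¹ of the k-th order tangent bundle T^kM are smooth diffeomorphisms, so T^kM is a smooth Banach manifold modeled on E^{k+1} and (π_k, T^kM, M) is a smooth fibre bundle.) -/

import Mathlib

open scoped BigOperators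

/-- The `i`-th `k`-jet component of a map `f` at `(x, ξ)`:
`F_i^f(x,ξ) = (1/i!) (dⁱ/dtⁱ)|_{t=0} f (x + ∑_{j=1}^k t^j ξ_j)`. -/
noncomputable def jetComp {E : Type*} [NormedAddCommGroup E] [NormedSpace ℝ E]
    (k : ℕ) (f : E → E) (x : E) (ξ : Fin k → E) (i : ℕ) : E :=
  ((1 : ℝ) / (i.factorial : ℝ)) •
    iteratedDeriv i (fun t : ℝ => f (x + ∑ j : Fin k, t ^ ((j : ℕ) + 1) • ξ j)) 0

/-- The `k`-jet prolongation `J^k f : E × E^k → E × E^k`,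
`(x,ξ) ↦ (f x, F_1^f(x,ξ), …, F_k^f(x,ξ))`. -/
noncomputable def jetProl {E : Type*} [NormedAddCommGroup E] [NormedSpace ℝ E]
    (k : ℕ) (f : E → E) (p : E × (Fin k → E)) : E × (Fin k → E) :=
  (f p.1, fun i : Fin k => jetComp k f p.1 p.2 ((i : ℕ) + 1))

open Filter Topology

theorem iteratedDeriv_prodMk {F G : Type*} [NormedAddCommGroup F] [NormedSpace ℝ F]
    [NormedAddCommGroup G] [NormedSpace ℝ G] {g : ℝ → F} {h : ℝ → G} {t : ℝ} {n : ℕ}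
    (hg : ContDiffAt ℝ n g t) (hh : ContDiffAt ℝ n h t) :
    iteratedDeriv n (fun s => (g s, h s)) t = (iteratedDeriv n g t, iteratedDeriv n h t) := by
  have hgh : ContDiffAt ℝ n (fun s => (g s, h s)) t := hg.prodMk hh
  have h1 := (ContinuousLinearMap.fst ℝ F G).iteratedFDeriv_comp_left hgh (i := n) le_rfl
  have h2 := (ContinuousLinearMap.snd ℝ F G).iteratedFDeriv_comp_left hgh (i := n) le_rfl
  refine Prod.ext ?_ ?_
  · exact (DFunLike.congr_fun h1 fun _ => 1).symm
  · exact (DFunLike.congr_fun h2 fun _ => 1).symm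

/-- The `n`-th derivative of `f ∘ g` at a point depends only on the `n`-jet of `g` there. -/
theorem iteratedDeriv_comp_congr {H : Type*} [NormedAddCommGroup H] [NormedSpace ℝ H] (n : ℕ) :
    ∀ {F : Type*} [NormedAddCommGroup F] [NormedSpace ℝ F] {f : F → H} {g h : ℝ → F} {t : ℝ},
      ContDiffAt ℝ (⊤ : ℕ∞) f (g t) → ContDiffAt ℝ (⊤ : ℕ∞) g t → ContDiffAt ℝ (⊤ : ℕ∞) h t →
      (∀ i ≤ n, iteratedDeriv i g t = iteratedDeriv i h t) →
      iteratedDeriv n (fun s => f (g s)) t = iteratedDeriv n (fun s => f (h s)) t := by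
  induction n with
  | zero =>
    intro F _ _ f g h t _ _ _ hjet
    simpa using congrArg f (by simpa using hjet 0 le_rfl)
  | succ n ih =>
    intro F _ _ f g h t hf hg hh hjet
    have h0 : g t = h t := by simpa using hjet 0 (Nat.zero_le _)
    have hderiv : ∀ {u : ℝ → F}, ContDiffAt ℝ (⊤ : ℕ∞) f (u t) → ContDiffAt ℝ (⊤ : ℕ∞) u t →
        deriv (fun s => f (u s)) =ᶠ[𝓝 t] fun s => fderiv ℝ f (u s) (deriv u s) := by
      intro u hfu hu
      have hf1 := (hfu.of_le (m := 1) (by simp)).eventually (by simp)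
      have hu1 := (hu.of_le (m := 1) (by simp)).eventually (by simp)
      filter_upwards [hu.continuousAt.eventually hf1, hu1] with s hfs hus
      exact fderiv_comp_deriv s (hfs.differentiableAt (by simp)) (hus.differentiableAt (by simp))
    have hsmooth : ∀ {u : ℝ → F}, ContDiffAt ℝ (⊤ : ℕ∞) u t →
        ContDiffAt ℝ (⊤ : ℕ∞) (deriv u) t := fun hu =>
      (hu.fderiv_right (m := (⊤ : ℕ∞)) (by simp)).clm_apply contDiffAt_const
    rw [iteratedDeriv_succ', iteratedDeriv_succ', (hderiv hf hg).iteratedDeriv_eq,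
      (hderiv (h0 ▸ hf) hh).iteratedDeriv_eq]
    refine ih (f := fun p : F × F => fderiv ℝ f p.1 p.2) (g := fun s => (g s, deriv g s))
      (h := fun s => (h s, deriv h s)) ?_ (hg.prodMk (hsmooth hg)) (hh.prodMk (hsmooth hh)) ?_
    · exact ((hf.fderiv_right (m := (⊤ : ℕ∞)) (by simp)).comp (g t, deriv g t)
        contDiffAt_fst).clm_apply contDiffAt_snd
    · intro i hi
      have hle : ((i : ℕ) : WithTop ℕ∞) ≤ ((⊤ : ℕ∞) : WithTop ℕ∞) := by exact_mod_cast le_top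
      rw [iteratedDeriv_prodMk (hg.of_le hle) ((hsmooth hg).of_le hle),
        iteratedDeriv_prodMk (hh.of_le hle) ((hsmooth hh).of_le hle),
        ← iteratedDeriv_succ', ← iteratedDeriv_succ', hjet i (by omega), hjet (i + 1) (by omega)]

/-- The iterated partial derivatives of a smooth map in a real variable are jointly smooth. -/
theorem ContDiffOn.iteratedDeriv_snd {P F : Type*} [NormedAddCommGroup P] [NormedSpace ℝ P]
    [NormedAddCommGroup F] [NormedSpace ℝ F] {G : P × ℝ → F} {W : Set (P × ℝ)} (hW : IsOpen W)
    (hG : ContDiffOn ℝ (⊤ : ℕ∞) G W) (n : ℕ) :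
    ContDiffOn ℝ (⊤ : ℕ∞) (fun q : P × ℝ => iteratedDeriv n (fun s => G (q.1, s)) q.2) W := by
  induction n with
  | zero => simpa using hG
  | succ n ih =>
    refine ((ih.fderiv_of_isOpen (m := (⊤ : ℕ∞)) hW (by simp)).clm_apply
      (contDiffOn_const (c := ((0, 1) : P × ℝ)))).congr fun q hq => ?_
    have hd := ((ih.contDiffAt (hW.mem_nhds hq)).differentiableAt (by simp)).hasFDerivAt
    have hline : HasDerivAt (fun s : ℝ => (q.1, s)) ((0, 1) : P × ℝ) q.2 :=
      (hasDerivAt_const q.2 q.1).prodMk (hasDerivAt_id q.2)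
    rw [iteratedDeriv_succ]
    exact (hd.comp_hasDerivAt q.2 hline).deriv

section JetProlongation

variable {E : Type*} [NormedAddCommGroup E] [NormedSpace ℝ E]

/-- The polynomial curve `t ↦ x + ∑ j, t ^ (j + 1) • ξ j`. -/
def jetCurve (k : ℕ) (p : E × (Fin k → E)) (t : ℝ) : E :=
  p.1 + ∑ j : Fin k, t ^ ((j : ℕ) + 1) • p.2 j

theorem jetComp_eq (k : ℕ) (f : E → E) (x : E) (ξ : Fin k → E) (i : ℕ) :
    jetComp k f x ξ i =
      ((1 : ℝ) / (i.factorial : ℝ)) • iteratedDeriv i (fun t => f (jetCurve k (x, ξ) t)) 0 := rfl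

theorem jetCurve_zero (k : ℕ) (p : E × (Fin k → E)) : jetCurve k p 0 = p.1 := by
  simp [jetCurve]

theorem contDiff_jetCurve_uncurry (k : ℕ) :
    ContDiff ℝ (⊤ : ℕ∞) (fun q : (E × (Fin k → E)) × ℝ => jetCurve k q.1 q.2) := by
  unfold jetCurve
  fun_prop

theorem contDiff_jetCurve (k : ℕ) (p : E × (Fin k → E)) :
    ContDiff ℝ (⊤ : ℕ∞) (jetCurve k p) := by
  unfold jetCurve
  fun_prop

theorem iteratedDeriv_jetCurve (k : ℕ) (p : E × (Fin k → E)) (i : Fin k) :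
    iteratedDeriv ((i : ℕ) + 1) (jetCurve k p) 0 = (((i : ℕ) + 1).factorial : ℝ) • p.2 i := by
  unfold jetCurve
  rw [iteratedDeriv_const_add (Nat.succ_pos _),
    iteratedDeriv_fun_sum fun j _ => by fun_prop]
  have hterm : ∀ j : Fin k,
      iteratedDeriv ((i : ℕ) + 1) (fun t : ℝ => t ^ ((j : ℕ) + 1) • p.2 j) 0 =
        if i = j then (((i : ℕ) + 1).factorial : ℝ) • p.2 i else 0 := by
    intro j
    rw [iteratedDeriv_smul_const (by fun_prop), iteratedDeriv_fun_pow_zero]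
    by_cases hij : i = j
    · simp [hij]
    · simp [hij, Fin.val_inj]
  simp [hterm]

theorem contDiffOn_jetProl {U : Set E} (hU : IsOpen U) {f : E → E}
    (hf : ContDiffOn ℝ (⊤ : ℕ∞) f U) (k : ℕ) :
    ContDiffOn ℝ (⊤ : ℕ∞) (jetProl k f) (U ×ˢ (Set.univ : Set (Fin k → E))) := by
  refine (hf.comp contDiffOn_fst fun p hp => hp.1).prodMk (contDiffOn_pi.2 fun i => ?_)
  have hc := contDiff_jetCurve_uncurry (E := E) k
  have hG := ContDiffOn.iteratedDeriv_snd (hU.preimage hc.continuous)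
    (hf.comp hc.contDiffOn fun q hq => hq) ((i : ℕ) + 1)
  have hslice : ContDiff ℝ (⊤ : ℕ∞) (fun p : E × (Fin k → E) => (p, (0 : ℝ))) := by fun_prop
  refine (hG.comp hslice.contDiffOn fun p hp => ?_).const_smul _
  simpa [jetCurve_zero] using hp

/-- The curve attached to `J^k f (p)` has the same `k`-jet at `0` as the image under `f` of the
curve attached to `p`. -/
theorem iteratedDeriv_jetCurve_jetProl (k : ℕ) (f : E → E) (p : E × (Fin k → E)) {i : ℕ}
    (hi : i ≤ k) :
    iteratedDeriv i (jetCurve k (jetProl k f p)) 0 =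
      iteratedDeriv i (fun t => f (jetCurve k p t)) 0 := by
  cases i with
  | zero => simp [jetCurve_zero, jetProl]
  | succ i =>
    rw [iteratedDeriv_jetCurve k (jetProl k f p) ⟨i, hi⟩]
    simp only [jetProl, jetComp_eq, smul_smul]
    rw [mul_one_div_cancel (by positivity), one_smul]

theorem jetProl_jetProl {U V : Set E} (hU : IsOpen U) (hV : IsOpen V) {ψ φ : E → E}
    (hψ : ContDiffOn ℝ (⊤ : ℕ∞) ψ U) (hφ : ContDiffOn ℝ (⊤ : ℕ∞) φ V) (hψUV : Set.MapsTo ψ U V)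
    (hleft : ∀ x ∈ U, φ (ψ x) = x) (k : ℕ) {p : E × (Fin k → E)} (hp : p.1 ∈ U) :
    jetProl k φ (jetProl k ψ p) = p := by
  refine Prod.ext (hleft _ hp) (funext fun i => ?_)
  have hc := contDiff_jetCurve k p
  have hp0 : jetCurve k p 0 ∈ U := by rwa [jetCurve_zero]
  have hψc : ContDiffAt ℝ (⊤ : ℕ∞) (fun t => ψ (jetCurve k p t)) 0 :=
    (hψ.contDiffAt (hU.mem_nhds hp0)).comp 0 hc.contDiffAt
  have hφ0 : ContDiffAt ℝ (⊤ : ℕ∞) φ (jetCurve k (jetProl k ψ p) 0) := by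
    rw [jetCurve_zero]
    exact hφ.contDiffAt (hV.mem_nhds (hψUV hp))
  have hid : (fun t => φ (ψ (jetCurve k p t))) =ᶠ[𝓝 0] jetCurve k p := by
    filter_upwards [hc.continuous.continuousAt.eventually (hU.mem_nhds hp0)] with t ht
    exact hleft _ ht
  have hcongr := iteratedDeriv_comp_congr ((i : ℕ) + 1) hφ0
    (contDiff_jetCurve k (jetProl k ψ p)).contDiffAt hψc
    fun j hj => iteratedDeriv_jetCurve_jetProl k ψ p (hj.trans i.isLt)
  change jetComp k φ _ _ _ = _
  rw [jetComp_eq, Prod.mk.eta, hcongr, hid.iteratedDeriv_eq, iteratedDeriv_jetCurve, smul_smul,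
    one_div_mul_cancel (by positivity), one_smul]

end JetProlongation

/-- **Theorem 2.1: the chart overlaps of `T^k M` are smooth diffeomorphisms.**
If `ψ : U → V` is a `C^∞` diffeomorphism with `C^∞` inverse `φ : V → U`, then the
`k`-jet prolongation `J^k ψ : U × E^k → V × E^k` is a `C^∞` diffeomorphism with
inverse `J^k φ`. -/
theorem jet_prolongation_diffeomorphism
    {E : Type*} [NormedAddCommGroup E] [NormedSpace ℝ E] [CompleteSpace E]
    (U V : Set E) (hU : IsOpen U) (hV : IsOpen V)
    (ψ φ : E → E) (hψ : ContDiffOn ℝ (⊤ : ℕ∞) ψ U) (hφ : ContDiffOn ℝ (⊤ : ℕ∞) φ V)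
    (hψUV : Set.MapsTo ψ U V) (hφVU : Set.MapsTo φ V U)
    (hleft : ∀ x ∈ U, φ (ψ x) = x) (hright : ∀ y ∈ V, ψ (φ y) = y)
    (k : ℕ) (hk : 1 ≤ k) :
    ContDiffOn ℝ (⊤ : ℕ∞) (jetProl k ψ) (U ×ˢ (Set.univ : Set (Fin k → E))) ∧
    ContDiffOn ℝ (⊤ : ℕ∞) (jetProl k φ) (V ×ˢ (Set.univ : Set (Fin k → E))) ∧
    Set.MapsTo (jetProl k ψ) (U ×ˢ (Set.univ : Set (Fin k → E)))
      (V ×ˢ (Set.univ : Set (Fin k → E))) ∧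
    Set.MapsTo (jetProl k φ) (V ×ˢ (Set.univ : Set (Fin k → E)))
      (U ×ˢ (Set.univ : Set (Fin k → E))) ∧
    (∀ p ∈ U ×ˢ (Set.univ : Set (Fin k → E)), jetProl k φ (jetProl k ψ p) = p) ∧
    (∀ p ∈ V ×ˢ (Set.univ : Set (Fin k → E)), jetProl k ψ (jetProl k φ p) = p) := by
  exact ⟨contDiffOn_jetProl hU hψ k, contDiffOn_jetProl hV hφ k,
    fun p hp => ⟨hψUV hp.1, Set.mem_univ _⟩, fun p hp => ⟨hφVU hp.1, Set.mem_univ _⟩,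
    fun p hp => jetProl_jetProl hU hV hψ hφ hψUV hleft k hp.1,
    fun p hp => jetProl_jetProl hV hU hφ hψ hφVU hright k hp.1⟩
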